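/- Let C be a cosemisimple coalgebra over an algebraically closed field k. Then C is the (internal) direct sum of its simple subcoalgebras, and every simple subcoalgebra of C is finite-dimensional, isomorphic as a coalgebra to the dual coalgebra M_n(k)* of a matrix algebra for some n ≥ 1. -/

import Mathlib

open TensorProduct

variable (k : Type*) {C : Type*}

/-- A submodule `V` of a coalgebra is a subcoalgebra if `Δ(V) ⊆ V ⊗ V`. -/
def IsSubcoalgebra [CommSemiring k] [AddCommMonoid C] [Module k C] [Coalgebra k C]
    (V : Submodule k C) : Prop :=
  ∀ x ∈ V, Coalgebra.comul (R := k) x ∈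
    LinearMap.range (TensorProduct.map V.subtype V.subtype)

/-- A simple subcoalgebra: a nonzero subcoalgebra with no proper nonzero subcoalgebras. -/
def IsSimpleSubcoalgebra [CommSemiring k] [AddCommMonoid C] [Module k C] [Coalgebra k C]
    (V : Submodule k C) : Prop :=
  IsSubcoalgebra k V ∧ V ≠ ⊥ ∧
    ∀ W : Submodule k C, W ≤ V → IsSubcoalgebra k W → W = ⊥ ∨ W = V

open Coalgebra WithConv LinearMap

section Actions

variable {k} [Field k] [AddCommGroup C] [Module k C]

/-- Elements of `M ⊗ N` are separated by functionals on the right factor. -/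
theorem tensor_ext_lTensor {M N : Type*} [AddCommGroup M] [Module k M] [AddCommGroup N]
    [Module k N] {s t : M ⊗[k] N}
    (h : ∀ f : Module.Dual k N,
      TensorProduct.rid k M (f.lTensor M s) = TensorProduct.rid k M (f.lTensor M t)) : s = t := by
  classical
  let b := Module.Basis.ofVectorSpace k N
  refine (TensorProduct.equivFinsuppOfBasisRight b).injective (Finsupp.ext fun i => ?_)
  simpa only [TensorProduct.equivFinsuppOfBasisRight_apply] using h (b.coord i)

/-- Elements of `M ⊗ N` are separated by functionals on the left factor. -/
theorem tensor_ext_rTensor {M N : Type*} [AddCommGroup M] [Module k M] [AddCommGroup N]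
    [Module k N] {s t : M ⊗[k] N}
    (h : ∀ f : Module.Dual k M,
      TensorProduct.lid k N (f.rTensor N s) = TensorProduct.lid k N (f.rTensor N t)) : s = t := by
  classical
  let b := Module.Basis.ofVectorSpace k M
  refine (TensorProduct.equivFinsuppOfBasisLeft b).injective (Finsupp.ext fun i => ?_)
  simpa only [TensorProduct.equivFinsuppOfBasisLeft_apply] using h (b.coord i)

/-- Elements of `M ⊗ N` are separated by pure tensors of functionals. -/
theorem tensor_ext_dual {M N : Type*} [AddCommGroup M] [Module k M] [AddCommGroup N]
    [Module k N] {s t : M ⊗[k] N}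
    (h : ∀ (f : Module.Dual k M) (g : Module.Dual k N),
      LinearMap.mul' k k (TensorProduct.map f g s) = LinearMap.mul' k k (TensorProduct.map f g t)) :
    s = t := by
  have key : ∀ (f : Module.Dual k M) (g : Module.Dual k N) (u : M ⊗[k] N),
      f (TensorProduct.rid k M (g.lTensor M u)) = LinearMap.mul' k k (TensorProduct.map f g u) := by
    intro f g u
    induction u with
    | zero => simp
    | tmul a b => simp [mul_comm]
    | add a b ha hb => simp only [map_add, ha, hb]
  refine tensor_ext_lTensor fun g => ?_
  rw [← sub_eq_zero, ← Module.forall_dual_apply_eq_zero_iff k]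
  intro f
  rw [map_sub, key, key, h, sub_self]

/-- A tensor all of whose slices lie in `V` lies in `V ⊗ V`. -/
theorem mem_range_map_subtype {M : Type*} [AddCommGroup M] [Module k M] {V : Submodule k M}
    {t : M ⊗[k] M}
    (hl : ∀ f : Module.Dual k M, TensorProduct.rid k M (f.lTensor M t) ∈ V)
    (hr : ∀ f : Module.Dual k M, TensorProduct.lid k M (f.rTensor M t) ∈ V) :
    t ∈ range (TensorProduct.map V.subtype V.subtype) := by
  obtain ⟨p, hp⟩ := V.subtype.exists_leftInverse_of_injective V.ker_subtype
  have hpV : ∀ x ∈ V, V.subtype (p x) = x := fun x hx =>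
    congrArg Subtype.val (LinearMap.congr_fun hp ⟨x, hx⟩)
  have key₁ : (V.subtype ∘ₗ p).rTensor M t = t := by
    refine tensor_ext_lTensor fun f => ?_
    have : ∀ u : M ⊗[k] M, TensorProduct.rid k M (f.lTensor M ((V.subtype ∘ₗ p).rTensor M u)) =
        V.subtype (p (TensorProduct.rid k M (f.lTensor M u))) := by
      intro u
      induction u with
      | zero => simp
      | tmul a b => simp
      | add a b ha hb => simp only [map_add, ha, hb]
    rw [this, hpV _ (hl f)]
  have key₂ : (V.subtype ∘ₗ p).lTensor M t = t := by
    refine tensor_ext_rTensor fun f => ?_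
    have : ∀ u : M ⊗[k] M, TensorProduct.lid k M (f.rTensor M ((V.subtype ∘ₗ p).lTensor M u)) =
        V.subtype (p (TensorProduct.lid k M (f.rTensor M u))) := by
      intro u
      induction u with
      | zero => simp
      | tmul a b => simp
      | add a b ha hb => simp only [map_add, ha, hb]
    rw [this, hpV _ (hr f)]
  refine ⟨TensorProduct.map p p t, ?_⟩
  rw [← LinearMap.comp_apply, ← TensorProduct.map_comp]
  conv_rhs => rw [← key₁, ← key₂]
  rw [← LinearMap.comp_apply, LinearMap.rTensor_comp_lTensor]

variable (k) in
theorem eq_of_forall_conv_apply {x y : C} (h : ∀ f : WithConv (C →ₗ[k] k), f x = f y) : x = y := by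
  rw [← sub_eq_zero, ← Module.forall_dual_apply_eq_zero_iff k]
  intro f
  rw [map_sub, sub_eq_zero]
  exact h (toConv f)

variable [Coalgebra k C]

/-- The left action `f ⇀ x = ∑ f(x₂) x₁` of the dual of a coalgebra. -/
noncomputable def leftHit (f : WithConv (C →ₗ[k] k)) : C →ₗ[k] C :=
  (TensorProduct.rid k C).toLinearMap ∘ₗ f.ofConv.lTensor C ∘ₗ comul

/-- The right action `x ↼ f = ∑ f(x₁) x₂` of the dual of a coalgebra. -/
noncomputable def rightHit (f : WithConv (C →ₗ[k] k)) : C →ₗ[k] C :=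
  (TensorProduct.lid k C).toLinearMap ∘ₗ f.ofConv.rTensor C ∘ₗ comul

theorem apply_leftHit (f g : WithConv (C →ₗ[k] k)) (x : C) :
    f (leftHit g x) = (f * g) x := by
  rw [convMul_apply]
  simp only [leftHit, LinearMap.comp_apply, LinearEquiv.coe_coe]
  induction comul (R := k) x with
  | zero => simp
  | tmul a b => simp [mul_comm]
  | add a b ha hb => simp only [map_add, ha, hb]

theorem apply_rightHit (f g : WithConv (C →ₗ[k] k)) (x : C) :
    f (rightHit g x) = (g * f) x := by
  rw [convMul_apply]
  simp only [rightHit, LinearMap.comp_apply, LinearEquiv.coe_coe]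
  induction comul (R := k) x with
  | zero => simp
  | tmul a b => simp
  | add a b ha hb => simp only [map_add, ha, hb]

theorem leftHit_leftHit (f g : WithConv (C →ₗ[k] k)) (x : C) :
    leftHit f (leftHit g x) = leftHit (f * g) x :=
  eq_of_forall_conv_apply k fun h => by simp only [apply_leftHit, mul_assoc]

theorem rightHit_rightHit (f g : WithConv (C →ₗ[k] k)) (x : C) :
    rightHit f (rightHit g x) = rightHit (g * f) x :=
  eq_of_forall_conv_apply k fun h => by simp only [apply_rightHit, mul_assoc]

theorem leftHit_rightHit (f g : WithConv (C →ₗ[k] k)) (x : C) :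
    leftHit f (rightHit g x) = rightHit g (leftHit f x) :=
  eq_of_forall_conv_apply k fun h => by simp only [apply_rightHit, apply_leftHit, mul_assoc]

@[simp]
theorem leftHit_one (x : C) : leftHit (1 : WithConv (C →ₗ[k] k)) x = x :=
  eq_of_forall_conv_apply k fun h => by rw [apply_leftHit, mul_one]

@[simp]
theorem rightHit_one (x : C) : rightHit (1 : WithConv (C →ₗ[k] k)) x = x :=
  eq_of_forall_conv_apply k fun h => by rw [apply_rightHit, one_mul]

theorem leftHit_congr {V : Submodule k C} (hV : IsSubcoalgebra k V)
    {f g : WithConv (C →ₗ[k] k)} (h : ∀ x ∈ V, f x = g x) {x : C} (hx : x ∈ V) :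
    leftHit f x = leftHit g x := by
  obtain ⟨t, ht⟩ := hV x hx
  simp only [leftHit, LinearMap.comp_apply, ← ht]
  clear ht
  induction t with
  | zero => simp
  | tmul a b => simp [h b b.2]
  | add a b ha hb => simp only [map_add, ha, hb]

theorem IsSubcoalgebra.leftHit_mem {V : Submodule k C} (hV : IsSubcoalgebra k V)
    (f : WithConv (C →ₗ[k] k)) {x : C} (hx : x ∈ V) : leftHit f x ∈ V := by
  obtain ⟨t, ht⟩ := hV x hx
  simp only [leftHit, LinearMap.comp_apply, ← ht]
  clear ht
  induction t with
  | zero => simp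
  | tmul a b => simpa using V.smul_mem _ a.2
  | add a b ha hb => simpa only [map_add] using V.add_mem ha hb

theorem IsSubcoalgebra.rightHit_mem {V : Submodule k C} (hV : IsSubcoalgebra k V)
    (f : WithConv (C →ₗ[k] k)) {x : C} (hx : x ∈ V) : rightHit f x ∈ V := by
  obtain ⟨t, ht⟩ := hV x hx
  simp only [rightHit, LinearMap.comp_apply, ← ht]
  clear ht
  induction t with
  | zero => simp
  | tmul a b => simpa using V.smul_mem _ b.2
  | add a b ha hb => simpa only [map_add] using V.add_mem ha hb

/-- Subcoalgebras are the submodules stable under both actions of the dual algebra. -/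
theorem isSubcoalgebra_of_stable {V : Submodule k C}
    (hl : ∀ f : WithConv (C →ₗ[k] k), ∀ x ∈ V, leftHit f x ∈ V)
    (hr : ∀ f : WithConv (C →ₗ[k] k), ∀ x ∈ V, rightHit f x ∈ V) : IsSubcoalgebra k V :=
  fun x hx => mem_range_map_subtype (fun f => hl (toConv f) x hx) (fun f => hr (toConv f) x hx)

theorem isSubcoalgebra_bot : IsSubcoalgebra k (⊥ : Submodule k C) :=
  isSubcoalgebra_of_stable (by simp) (by simp)

theorem IsSubcoalgebra.inf {V W : Submodule k C} (hV : IsSubcoalgebra k V)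
    (hW : IsSubcoalgebra k W) : IsSubcoalgebra k (V ⊓ W) :=
  isSubcoalgebra_of_stable
    (fun f _ hx => ⟨hV.leftHit_mem f hx.1, hW.leftHit_mem f hx.2⟩)
    (fun f _ hx => ⟨hV.rightHit_mem f hx.1, hW.rightHit_mem f hx.2⟩)

theorem IsSubcoalgebra.sup {V W : Submodule k C} (hV : IsSubcoalgebra k V)
    (hW : IsSubcoalgebra k W) : IsSubcoalgebra k (V ⊔ W) := by
  intro x hx
  obtain ⟨v, hv, w, hw, rfl⟩ := Submodule.mem_sup.mp hx
  rw [map_add]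
  refine Submodule.add_mem _ ?_ ?_
  · exact TensorProduct.range_map_mono (by simp) (by simp) (hV v hv)
  · exact TensorProduct.range_map_mono (by simp) (by simp) (hW w hw)

/-- The subcoalgebra generated by `x`. -/
theorem isSubcoalgebra_span_hit (x : C) : IsSubcoalgebra k (Submodule.span k
    (Set.range fun p : WithConv (C →ₗ[k] k) × WithConv (C →ₗ[k] k) =>
      rightHit p.2 (leftHit p.1 x))) := by
  refine isSubcoalgebra_of_stable (fun f y hy => ?_) (fun f y hy => ?_)
  · rw [← Submodule.mem_comap]
    refine Submodule.span_le.mpr ?_ hy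
    rintro _ ⟨p, rfl⟩
    refine Submodule.subset_span ⟨(f * p.1, p.2), ?_⟩
    simp only [leftHit_rightHit, leftHit_leftHit]
  · rw [← Submodule.mem_comap]
    refine Submodule.span_le.mpr ?_ hy
    rintro _ ⟨p, rfl⟩
    refine Submodule.subset_span ⟨(p.1, p.2 * f), ?_⟩
    simp only [rightHit_rightHit]

theorem exists_fg_leftHit_mem (x : C) : ∃ P : Submodule k C, P.FG ∧
    ∀ f : WithConv (C →ₗ[k] k), leftHit f x ∈ P := by
  simp only [leftHit, LinearMap.comp_apply, LinearEquiv.coe_coe]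
  induction comul (R := k) x with
  | zero => exact ⟨⊥, Submodule.fg_bot, by simp⟩
  | tmul a b =>
    refine ⟨k ∙ a, Submodule.fg_span_singleton a, fun f => ?_⟩
    simpa using Submodule.smul_mem _ _ (Submodule.mem_span_singleton_self a)
  | add a b ha hb =>
    obtain ⟨P, hP, hP'⟩ := ha
    obtain ⟨Q, hQ, hQ'⟩ := hb
    exact ⟨P ⊔ Q, hP.sup hQ, fun f => by
      simpa only [map_add] using Submodule.add_mem_sup (hP' f) (hQ' f)⟩

theorem exists_fg_rightHit_mem (x : C) : ∃ P : Submodule k C, P.FG ∧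
    ∀ f : WithConv (C →ₗ[k] k), rightHit f x ∈ P := by
  simp only [rightHit, LinearMap.comp_apply, LinearEquiv.coe_coe]
  induction comul (R := k) x with
  | zero => exact ⟨⊥, Submodule.fg_bot, by simp⟩
  | tmul a b =>
    refine ⟨k ∙ b, Submodule.fg_span_singleton b, fun f => ?_⟩
    simpa using Submodule.smul_mem _ _ (Submodule.mem_span_singleton_self b)
  | add a b ha hb =>
    obtain ⟨P, hP, hP'⟩ := ha
    obtain ⟨Q, hQ, hQ'⟩ := hb
    exact ⟨P ⊔ Q, hP.sup hQ, fun f => by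
      simpa only [map_add] using Submodule.add_mem_sup (hP' f) (hQ' f)⟩

theorem exists_fg_rightHit_mem_of_fg (S : Submodule k C) (hS : S.FG) :
    ∃ P : Submodule k C, P.FG ∧ ∀ f : WithConv (C →ₗ[k] k), ∀ x ∈ S, rightHit f x ∈ P := by
  induction S, hS using Submodule.fg_induction with
  | singleton x =>
    obtain ⟨P, hP, hP'⟩ := exists_fg_rightHit_mem (k := k) x
    refine ⟨P, hP, fun f y hy => ?_⟩
    obtain ⟨c, rfl⟩ := Submodule.mem_span_singleton.mp hy
    simpa using P.smul_mem c (hP' f)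
  | sup S T _ _ hS hT =>
    obtain ⟨P, hP, hP'⟩ := hS
    obtain ⟨Q, hQ, hQ'⟩ := hT
    refine ⟨P ⊔ Q, hP.sup hQ, fun f y hy => ?_⟩
    obtain ⟨s, hs, t, ht, rfl⟩ := Submodule.mem_sup.mp hy
    simpa only [map_add] using Submodule.add_mem_sup (hP' f s hs) (hQ' f t ht)

/-- Simple subcoalgebras are finite-dimensional. -/
theorem IsSimpleSubcoalgebra.finiteDimensional {V : Submodule k C}
    (hV : IsSimpleSubcoalgebra k V) : FiniteDimensional k V := by
  obtain ⟨hsub, hne, hmin⟩ := hV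
  obtain ⟨x, hxV, hx0⟩ := V.exists_mem_ne_zero_of_ne_bot hne
  obtain ⟨S, hS, hS'⟩ := exists_fg_leftHit_mem (k := k) x
  obtain ⟨P, hP, hP'⟩ := exists_fg_rightHit_mem_of_fg S hS
  have hxW : x ∈ Submodule.span k
      (Set.range fun p : WithConv (C →ₗ[k] k) × WithConv (C →ₗ[k] k) =>
        rightHit p.2 (leftHit p.1 x)) := Submodule.subset_span ⟨(1, 1), by simp⟩
  have hWV := hmin _ (Submodule.span_le.mpr ?_) (isSubcoalgebra_span_hit x)
  · rcases hWV with h | h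
    · rw [h, Submodule.mem_bot] at hxW
      exact absurd hxW hx0
    · have : FiniteDimensional k P := Module.Finite.iff_fg.mpr hP
      refine Submodule.finiteDimensional_of_le (S₂ := P) ?_
      rw [← h, Submodule.span_le]
      rintro _ ⟨p, rfl⟩
      exact hP' _ _ (hS' _)
  · rintro _ ⟨p, rfl⟩
    exact hsub.rightHit_mem _ (hsub.leftHit_mem _ hxV)

/-- A linear functional on a subspace extends by zero to any disjoint subspace. -/
theorem exists_functional_of_disjoint {M : Type*} [AddCommGroup M] [Module k M]
    {V W : Submodule k M} (h : Disjoint V W) (g : Module.Dual k M) :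
    ∃ f : Module.Dual k M, (∀ x ∈ V, f x = g x) ∧ ∀ x ∈ W, f x = 0 := by
  obtain ⟨p, hp⟩ := (W.mkQ ∘ₗ V.subtype).exists_leftInverse_of_injective (by
    rw [LinearMap.ker_comp, Submodule.ker_mkQ, ← Submodule.disjoint_iff_comap_eq_bot]
    exact h)
  refine ⟨g ∘ₗ V.subtype ∘ₗ p ∘ₗ W.mkQ, fun x hx => ?_, fun x hx => ?_⟩
  · exact congrArg (fun v : V => g v) (LinearMap.congr_fun hp ⟨x, hx⟩)
  · simp [(Submodule.Quotient.mk_eq_zero W).mpr hx]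

/-- A simple subcoalgebra contained in a sum of two subcoalgebras lies in one of them. -/
theorem IsSimpleSubcoalgebra.le_or_le_of_le_sup {V W₁ W₂ : Submodule k C}
    (hV : IsSimpleSubcoalgebra k V) (h₁ : IsSubcoalgebra k W₁) (h₂ : IsSubcoalgebra k W₂)
    (h : V ≤ W₁ ⊔ W₂) : V ≤ W₁ ∨ V ≤ W₂ := by
  rcases hV.2.2 _ inf_le_left (hV.1.inf h₁) with hbot | hle
  · refine Or.inr fun x hx => ?_
    obtain ⟨f, hfV, hfW⟩ := exists_functional_of_disjoint (disjoint_iff.mpr hbot)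
      (1 : WithConv (C →ₗ[k] k)).ofConv
    obtain ⟨y, hy, z, hz, rfl⟩ := Submodule.mem_sup.mp (h hx)
    have hx' : leftHit (toConv f) (y + z) = y + z := by
      rw [leftHit_congr hV.1 hfV hx, leftHit_one]
    have hy' : leftHit (toConv f) y = 0 := by
      rw [leftHit_congr h₁ (g := 0) hfW hy]
      simp [leftHit]
    rw [← hx', map_add, hy', zero_add]
    exact h₂.leftHit_mem _ hz
  · exact Or.inl (inf_eq_left.mp hle)

theorem IsSubcoalgebra.finset_sup {F : Finset (Submodule k C)}
    (hF : ∀ W ∈ F, IsSubcoalgebra k W) : IsSubcoalgebra k (F.sup id) :=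
  Finset.sup_induction isSubcoalgebra_bot (fun _ hV _ hW => hV.sup hW) hF

theorem IsSimpleSubcoalgebra.exists_le_of_le_finset_sup {V : Submodule k C}
    (hV : IsSimpleSubcoalgebra k V) (F : Finset (Submodule k C))
    (hF : ∀ W ∈ F, IsSubcoalgebra k W) (h : V ≤ F.sup id) : ∃ W ∈ F, V ≤ W := by
  classical
  induction F using Finset.induction_on with
  | empty => exact absurd (le_bot_iff.mp h) hV.2.1
  | insert W F _ ih =>
    rw [Finset.sup_insert] at h
    have hF' : ∀ W ∈ F, IsSubcoalgebra k W := fun U hU => hF U (Finset.mem_insert_of_mem hU)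
    rcases hV.le_or_le_of_le_sup (hF W (Finset.mem_insert_self W F)) (.finset_sup hF') h with h | h
    · exact ⟨W, Finset.mem_insert_self W F, h⟩
    · obtain ⟨U, hU, hVU⟩ := ih hF' h
      exact ⟨U, Finset.mem_insert_of_mem hU, hVU⟩

variable (k C) in
/-- Distinct simple subcoalgebras are independent. -/
theorem sSupIndep_isSimpleSubcoalgebra :
    sSupIndep {V : Submodule k C | IsSimpleSubcoalgebra k V} := by
  intro V hV
  rw [Submodule.disjoint_def]
  intro x hxV hx
  by_contra hx0
  obtain ⟨F, hF, hxF⟩ := Submodule.mem_sSup_iff_exists_finset.mp hx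
  replace hF : ∀ W ∈ F, IsSimpleSubcoalgebra k W ∧ W ≠ V := hF
  have hFsub : ∀ W ∈ F, IsSubcoalgebra k W := fun W hW => (hF W hW).1.1
  replace hxF : x ∈ F.sup id := by rwa [Finset.sup_eq_iSup]
  rcases hV.2.2 _ inf_le_left (hV.1.inf (.finset_sup hFsub)) with h | h
  · exact hx0 ((Submodule.mem_bot k).mp (h ▸ ⟨hxV, hxF⟩))
  · obtain ⟨W, hWF, hVW⟩ := hV.exists_le_of_le_finset_sup F hFsub (inf_eq_left.mp h)
    rcases (hF W hWF).1.2.2 V hVW hV.1 with h | h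
    · exact hV.2.1 h
    · exact (hF W hWF).2 h.symm

/-- The ideal of the dual algebra formed by the functionals vanishing on a subcoalgebra. -/
def IsSubcoalgebra.annihilator {V : Submodule k C} (hV : IsSubcoalgebra k V) :
    Ideal (WithConv (C →ₗ[k] k)) where
  carrier := {f | ∀ x ∈ V, f x = 0}
  zero_mem' := fun _ _ => rfl
  add_mem' := fun {f g} hf hg x hx => by
    change f x + g x = 0
    rw [hf x hx, hg x hx, add_zero]
  smul_mem' := fun g f hf x hx => by
    rw [smul_eq_mul, ← apply_rightHit]
    exact hf _ (hV.rightHit_mem g hx)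

theorem IsSubcoalgebra.mem_annihilator {V : Submodule k C} (hV : IsSubcoalgebra k V)
    {f : WithConv (C →ₗ[k] k)} : f ∈ hV.annihilator ↔ ∀ x ∈ V, f x = 0 := Iff.rfl

instance IsSubcoalgebra.isTwoSided_annihilator {V : Submodule k C} (hV : IsSubcoalgebra k V) :
    hV.annihilator.IsTwoSided where
  mul_mem_of_left := fun {f} g hf x hx => by
    rw [← apply_leftHit]
    exact hf _ (hV.leftHit_mem g hx)

/-- There is a linear map sending a functional on a subcoalgebra to the class of its extensions. -/
theorem IsSubcoalgebra.exists_extension {V : Submodule k C} (hV : IsSubcoalgebra k V) :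
    ∃ s : Module.Dual k V →ₗ[k] WithConv (C →ₗ[k] k) ⧸ hV.annihilator,
      ∀ f : WithConv (C →ₗ[k] k),
        s (f.ofConv ∘ₗ V.subtype) = Ideal.Quotient.mkₐ k hV.annihilator f := by
  obtain ⟨p, hp⟩ := V.subtype.exists_leftInverse_of_injective V.ker_subtype
  refine ⟨(Ideal.Quotient.mkₐ k hV.annihilator).toLinearMap ∘ₗ
    (WithConv.linearEquiv k (C →ₗ[k] k)).symm.toLinearMap ∘ₗ p.dualMap, fun f => ?_⟩
  refine Ideal.Quotient.eq.mpr fun x hx => ?_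
  have hpx : p x = ⟨x, hx⟩ := LinearMap.congr_fun hp ⟨x, hx⟩
  change f (V.subtype (p x)) - f x = 0
  rw [hpx]
  exact sub_self _

/-- The dual algebra of a simple subcoalgebra is a simple ring. -/
theorem IsSimpleSubcoalgebra.isSimpleRing {V : Submodule k C} (hV : IsSimpleSubcoalgebra k V) :
    IsSimpleRing (WithConv (C →ₗ[k] k) ⧸ hV.1.annihilator) := by
  have := hV.finiteDimensional
  have : Nontrivial (WithConv (C →ₗ[k] k) ⧸ hV.1.annihilator) := by
    refine Ideal.Quotient.nontrivial_iff.mpr fun htop => hV.2.1 ?_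
    rw [Submodule.eq_bot_iff]
    intro x hx
    refine eq_of_forall_conv_apply k fun f => ?_
    rw [hV.1.mem_annihilator.mp (htop ▸ Submodule.mem_top) x hx, map_zero]
  refine ⟨⟨fun J => ?_⟩⟩
  let W : Submodule k C :=
    { carrier := {x | x ∈ V ∧ ∀ f : WithConv (C →ₗ[k] k),
        Ideal.Quotient.mk hV.1.annihilator f ∈ J → f x = 0}
      zero_mem' := ⟨V.zero_mem, fun f _ => map_zero _⟩
      add_mem' := fun {x y} hx hy => ⟨V.add_mem hx.1 hy.1, fun f hf => by
        rw [map_add, hx.2 f hf, hy.2 f hf, add_zero]⟩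
      smul_mem' := fun c x hx => ⟨V.smul_mem c hx.1, fun f hf => by
        rw [map_smul, hx.2 f hf, smul_zero]⟩ }
  have hW : IsSubcoalgebra k W := isSubcoalgebra_of_stable
    (fun f x hx => ⟨hV.1.leftHit_mem f hx.1, fun g hg => by
      rw [apply_leftHit]
      exact hx.2 _ (by rw [map_mul]; exact J.mul_mem_right _ _ hg)⟩)
    (fun f x hx => ⟨hV.1.rightHit_mem f hx.1, fun g hg => by
      rw [apply_rightHit]
      exact hx.2 _ (by rw [map_mul]; exact J.mul_mem_left _ _ hg)⟩)
  rcases hV.2.2 W (fun x hx => hx.1) hW with h | h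
  · right
    let K : Submodule k (Module.Dual k V) :=
      { carrier := {φ | ∃ f : WithConv (C →ₗ[k] k),
          Ideal.Quotient.mk hV.1.annihilator f ∈ J ∧ f.ofConv ∘ₗ V.subtype = φ}
        zero_mem' := ⟨0, by rw [map_zero]; exact J.zero_mem, rfl⟩
        add_mem' := by
          rintro _ _ ⟨f, hf, rfl⟩ ⟨g, hg, rfl⟩
          exact ⟨f + g, by rw [map_add]; exact J.add_mem hf hg, rfl⟩
        smul_mem' := by
          rintro c _ ⟨f, hf, rfl⟩
          refine ⟨c • f, ?_, rfl⟩
          rw [Algebra.smul_def, map_mul]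
          exact J.mul_mem_left _ _ hf }
    have hK : K = ⊤ := by
      rw [← Subspace.dualCoannihilator_dualAnnihilator_eq (W := K)]
      rw [show K.dualCoannihilator = ⊥ from ?_, Submodule.dualAnnihilator_bot]
      rw [Submodule.eq_bot_iff]
      intro x hx
      have : (x : C) ∈ W := ⟨x.2, fun f hf =>
        (Submodule.mem_dualCoannihilator x).mp hx _ ⟨f, hf, rfl⟩⟩
      rw [h, Submodule.mem_bot] at this
      exact Subtype.ext this
    obtain ⟨f, hf, hf1⟩ : (1 : WithConv (C →ₗ[k] k)).ofConv ∘ₗ V.subtype ∈ K :=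
      hK ▸ Submodule.mem_top
    have : Ideal.Quotient.mk hV.1.annihilator f = 1 := by
      rw [← map_one (Ideal.Quotient.mk hV.1.annihilator), Ideal.Quotient.eq]
      intro x hx
      exact sub_eq_zero.mpr (LinearMap.congr_fun hf1 ⟨x, hx⟩)
    exact (TwoSidedIdeal.one_mem_iff J).mp (this ▸ hf)
  · left
    refine le_bot_iff.mp fun a ha => ?_
    obtain ⟨f, rfl⟩ := Ideal.Quotient.mk_surjective a
    rw [TwoSidedIdeal.mem_bot]
    refine Ideal.Quotient.eq_zero_iff_mem.mpr fun x hx => ?_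
    exact (h.symm ▸ hx : x ∈ W).2 f ha

/-- Over an algebraically closed field, every simple subcoalgebra has a comatrix basis. -/
theorem IsSimpleSubcoalgebra.exists_comatrix_basis [IsAlgClosed k] {V : Submodule k C}
    (hV : IsSimpleSubcoalgebra k V) :
    ∃ n : ℕ, 0 < n ∧ ∃ e : Fin n → Fin n → C,
      LinearIndependent k (fun p : Fin n × Fin n => e p.1 p.2) ∧
      Submodule.span k (Set.range fun p : Fin n × Fin n => e p.1 p.2) = V ∧
      (∀ i j, comul (R := k) (e i j) = ∑ l, e i l ⊗ₜ[k] e l j) ∧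
      (∀ i j, counit (R := k) (e i j) = if i = j then (1 : k) else 0) := by
  have := hV.finiteDimensional
  have := hV.isSimpleRing
  obtain ⟨s, hs⟩ := hV.1.exists_extension
  have : FiniteDimensional k (WithConv (C →ₗ[k] k) ⧸ hV.1.annihilator) :=
    Module.Finite.of_surjective s fun a => by
      obtain ⟨f, rfl⟩ := Ideal.Quotient.mkₐ_surjective k _ a
      exact ⟨_, hs f⟩
  obtain ⟨n, hn, ⟨E⟩⟩ := IsSimpleRing.exists_algEquiv_matrix_of_isAlgClosed k
    (WithConv (C →ₗ[k] k) ⧸ hV.1.annihilator)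
  let Φ : WithConv (C →ₗ[k] k) →ₐ[k] Matrix (Fin n) (Fin n) k :=
    E.toAlgHom.comp (Ideal.Quotient.mkₐ k hV.1.annihilator)
  have hΦ : Function.Surjective Φ := E.surjective.comp (Ideal.Quotient.mkₐ_surjective k _)
  have hker : ∀ f, Φ f = 0 → ∀ x ∈ V, f x = 0 := fun f hf =>
    Ideal.Quotient.eq_zero_iff_mem.mp ((map_eq_zero_iff E E.injective).mp hf)
  let e : Fin n → Fin n → V := fun i j => (Module.evalEquiv k V).symm
    (Matrix.entryLinearMap k k i j ∘ₗ E.toLinearMap ∘ₗ s)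
  have he : ∀ (f : WithConv (C →ₗ[k] k)) i j, f (e i j) = Φ f i j := fun f i j => by
    have := Module.apply_evalEquiv_symm_apply k V (f.ofConv ∘ₗ V.subtype)
      (Matrix.entryLinearMap k k i j ∘ₗ E.toLinearMap ∘ₗ s)
    simp only [LinearMap.comp_apply, hs] at this
    exact this
  refine ⟨n, Nat.pos_of_ne_zero hn.out, fun i j => e i j, ?_, ?_, fun i j => ?_, fun i j => ?_⟩
  · rw [Fintype.linearIndependent_iff]
    rintro c hc ⟨i, j⟩
    obtain ⟨f, hf⟩ := hΦ (Matrix.single i j 1)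
    have := congrArg f.ofConv hc
    simpa [he, hf, Matrix.single_apply, Fintype.sum_prod_type, ite_and] using this
  · refine le_antisymm (Submodule.span_le.mpr ?_) fun x hx => ?_
    · rintro _ ⟨p, rfl⟩
      exact (e p.1 p.2).2
    · by_contra hxs
      obtain ⟨f, hfx, hf⟩ := Submodule.exists_le_ker_of_notMem hxs
      refine hfx (hker (toConv f) (Matrix.ext fun i j => ?_) x hx)
      rw [← he]
      exact hf (Submodule.subset_span ⟨(i, j), rfl⟩)
  · refine tensor_ext_dual fun f g => ?_
    have := he (toConv f * toConv g) i j
    rw [convMul_apply, map_mul, Matrix.mul_apply] at this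
    simp only [← he] at this
    simpa using this
  · have := he 1 i j
    rw [map_one, Matrix.one_apply] at this
    exact this

end Actions

/-- A cosemisimple coalgebra over an algebraically closed field is the internal direct
sum of its simple subcoalgebras, and every simple subcoalgebra is finite-dimensional and
isomorphic as a coalgebra to a matrix coalgebra `Mₙ(k)*` (witnessed by a comatrix basis). -/
theorem cosemisimple_coalgebra_structure
    [Field k] [IsAlgClosed k] [AddCommGroup C] [Module k C] [Coalgebra k C]
    (hcss : sSup {V : Submodule k C | IsSimpleSubcoalgebra k V} = ⊤) :
    sSupIndep {V : Submodule k C | IsSimpleSubcoalgebra k V} ∧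
      (∀ V : Submodule k C, IsSimpleSubcoalgebra k V →
        FiniteDimensional k V ∧
          ∃ n : ℕ, 0 < n ∧ ∃ e : Fin n → Fin n → C,
            LinearIndependent k (fun p : Fin n × Fin n => e p.1 p.2) ∧
            Submodule.span k (Set.range fun p : Fin n × Fin n => e p.1 p.2) = V ∧
            (∀ i j, Coalgebra.comul (R := k) (e i j) = ∑ l, e i l ⊗ₜ[k] e l j) ∧
            (∀ i j, Coalgebra.counit (R := k) (e i j) = if i = j then (1 : k) else 0)) := by
  exact ⟨sSupIndep_isSimpleSubcoalgebra k C, fun V hV =>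
    ⟨hV.finiteDimensional, hV.exists_comatrix_basis⟩⟩
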